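/- arXiv:1005.0129 — 2 statements merged into one kernel-verified Lean document; each statement's English description precedes it below -/
import Mathlib

section
/- For every integer n ≥ 4, the automaton 𝒟''_n is synchronizing and its reset length (the minimum length of a reset word) is exactly n² − 3n + 2. -/
/-- The two input letters of the automaton. -/
inductive Letter | a | b

/-- Transition function of the automaton `𝒟''ₙ` on states `{1, …, n}`:
`δ(i,a) = δ(i,b) = i+1` for `1 ≤ i ≤ n-2`, `δ(n-1,a) = 1`, `δ(n-1,b) = n`,
`δ(n,a) = 1`, `δ(n,b) = 2`. -/
def delta (n : ℕ) (q : ℕ) : Letter → ℕ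
  | Letter.a => if q < n - 1 then q + 1 else if q = n - 1 then 1 else 1
  | Letter.b => if q < n - 1 then q + 1 else if q = n - 1 then n else 2

/-- `w` is a reset word: it sends every state in `{1, …, n}` to one single state. -/
def IsReset (n : ℕ) (w : List Letter) : Prop :=
  ∃ p : ℕ, ∀ q ∈ Finset.Icc 1 n, w.foldl (delta n) q = p

/-- Every run of `𝒟''ₙ` winds around cycles of length `n - 1` and `n`: its length is determined
by its endpoints up to a nonnegative combination of these two numbers. -/
theorem exists_length_add_eq (n : ℕ) (hn : 4 ≤ n) (w : List Letter) (q : ℕ)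
    (h1 : 1 ≤ q) (h2 : q ≤ n) :
    1 ≤ w.foldl (delta n) q ∧
      ∃ x y : ℕ, w.length + q = w.foldl (delta n) q + x * (n - 1) + y * n := by
  induction w generalizing q with
  | nil => exact ⟨h1, 0, 0, by simp⟩
  | cons c w ih =>
    have step : 1 ≤ delta n q c ∧ delta n q c ≤ n ∧ (q + 1 = delta n q c ∨
        q + 1 = delta n q c + (n - 1) ∨ q + 1 = delta n q c + n) := by
      cases c <;> simp only [delta] <;> split_ifs <;> omega
    obtain ⟨l, u, h⟩ := step
    obtain ⟨hp, x, y, hxy⟩ := ih _ l u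
    refine ⟨hp, ?_⟩
    simp only [List.foldl_cons, List.length_cons]
    rcases h with h | h | h
    · exact ⟨x, y, by omega⟩
    · exact ⟨x + 1, y, by rw [add_mul]; omega⟩
    · exact ⟨x, y + 1, by rw [add_mul]; omega⟩

/-- The number `k * m + (m - 1)` is not in the semigroup generated
by `m` and `m + 1`, if `k + 1 < m`. -/
theorem mul_add_pred_ne (m k x y : ℕ) (hk : k + 1 < m) :
    k * m + (m - 1) ≠ x * m + y * (m + 1) := by
  intro h
  have h' : k * m + (m - 1) = (x + y) * m + y := by rw [h]; ring
  have hxy : x + y ≤ k := by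
    by_contra! hlt
    have := Nat.mul_le_mul_right m (Nat.succ_le_of_lt hlt)
    rw [Nat.succ_mul] at this
    omega
  have hlt : y < m := by omega
  have := congrArg (· % m) h'
  simp only [Nat.mul_add_mod_self_right, Nat.mod_eq_of_lt hlt,
    Nat.mod_eq_of_lt (show m - 1 < m by omega)] at this
  omega

theorem le_length_of_isReset (n : ℕ) (hn : 4 ≤ n) (w : List Letter) (hw : IsReset n w) :
    (n - 1) * (n - 2) ≤ w.length := by
  obtain ⟨p, hp⟩ := hw
  have run : ∀ q, 1 ≤ q → q ≤ n →
      1 ≤ p ∧ ∃ x y : ℕ, w.length + q = p + x * (n - 1) + y * n := by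
    intro q h1 h2
    have := exists_length_add_eq n hn w q h1 h2
    rwa [hp q (Finset.mem_Icc.2 ⟨h1, h2⟩)] at this
  obtain ⟨m, rfl⟩ : ∃ m, n = m + 1 := ⟨n - 1, by omega⟩
  simp only [Nat.add_sub_cancel] at run ⊢
  obtain ⟨hp1, x, y, hxy⟩ := run 1 le_rfl (by omega)
  by_contra! hlt
  -- `M` is the length of a virtual run from `1` to `1`
  obtain ⟨M, hM⟩ : ∃ M, w.length + 1 = p + M := ⟨x * m + y * (m + 1), by omega⟩
  have hdm := Nat.div_add_mod M m
  have hmod := Nat.mod_lt M (show 0 < m by omega)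
  obtain ⟨-, x, y, hxy⟩ := run (m - M % m) (by omega) (by omega)
  refine mul_add_pred_ne m (M / m) x y ?_ ?_
  · have : M / m < m - 1 := by
      rw [Nat.div_lt_iff_lt_mul (by omega), mul_comm]
      have : m + 1 - 2 = m - 1 := by omega
      rw [this] at hlt
      omega
    omega
  · rw [mul_comm]
    omega

theorem foldl_replicate_a (n j q : ℕ) (h : q + j ≤ n - 1) :
    (List.replicate j Letter.a).foldl (delta n) q = q + j := by
  induction j generalizing q with
  | zero => rfl
  | succ j ih =>
    rw [List.replicate_succ, List.foldl_cons]
    have : delta n q Letter.a = q + 1 := by simp only [delta]; rw [if_pos (by omega)]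
    rw [this, ih _ (by omega)]
    omega

/-- The letter `a` permutes `{1, …, n - 1}` cyclically. -/
theorem foldl_replicate_a_cycle (n q : ℕ) (h1 : 1 ≤ q) (h2 : q ≤ n - 1) :
    (List.replicate (n - 1) Letter.a).foldl (delta n) q = q := by
  have hsplit : n - 1 = (n - 1 - q) + ((q - 1) + 1) := by omega
  have hlast : delta n (q + (n - 1 - q)) Letter.a = 1 := by simp [delta]; omega
  rw [hsplit, List.replicate_add, List.foldl_append, foldl_replicate_a n (n - 1 - q) q (by omega),
    List.replicate_succ, List.foldl_cons, hlast, foldl_replicate_a n _ _ (by omega)]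
  omega

theorem foldl_replicate_a_top (n : ℕ) (hn : 4 ≤ n) :
    (List.replicate (n - 1) Letter.a).foldl (delta n) n = n - 1 := by
  have hsplit : n - 1 = (n - 2) + 1 := by omega
  have hfirst : delta n n Letter.a = 1 := by simp [delta]
  rw [hsplit, List.replicate_succ, List.foldl_cons, hfirst, foldl_replicate_a n _ _ (by omega)]
  omega

/-- The word `(b aⁿ⁻¹)ʲ` shifts `{1, …, n - 1}` up by `j`, truncating at `n - 1`. -/
theorem exists_shift_word (n : ℕ) (hn : 4 ≤ n) (j : ℕ) :
    ∃ w : List Letter, w.length = j * n ∧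
      (∀ q, 1 ≤ q → q ≤ n - 1 → w.foldl (delta n) q = min (q + j) (n - 1)) ∧
      (0 < j → w.foldl (delta n) n = min (j + 1) (n - 1)) := by
  induction j with
  | zero => exact ⟨[], by simp, fun q _ h => by simp [h], by simp⟩
  | succ j ih =>
    obtain ⟨w, hlen, hw, -⟩ := ih
    refine ⟨Letter.b :: List.replicate (n - 1) Letter.a ++ w, ?_, fun q h1 h2 => ?_, fun _ => ?_⟩
    · simp only [List.cons_append, List.length_cons, List.length_append, List.length_replicate,
        hlen, add_mul]
      omega
    · rw [List.foldl_append, List.foldl_cons]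
      rcases h2.lt_or_eq with h | rfl
      · have : delta n q Letter.b = q + 1 := by simp only [delta]; rw [if_pos h]
        rw [this, foldl_replicate_a_cycle n _ (by omega) (by omega), hw _ (by omega) (by omega)]
        omega
      · have : delta n (n - 1) Letter.b = n := by simp [delta]
        rw [this, foldl_replicate_a_top n hn, hw _ (by omega) le_rfl]
        omega
    · have : delta n n Letter.b = 2 := by
        simp only [delta]; rw [if_neg (by omega), if_neg (by omega)]
      rw [List.foldl_append, List.foldl_cons, this,
        foldl_replicate_a_cycle n _ (by omega) (by omega), hw _ (by omega) (by omega)]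
      omega

theorem exists_isReset (n : ℕ) (hn : 4 ≤ n) :
    ∃ w : List Letter, IsReset n w ∧ w.length = (n - 3) * n + 2 := by
  obtain ⟨w, hlen, hw, hw'⟩ := exists_shift_word n hn (n - 3)
  refine ⟨w ++ [Letter.b, Letter.a], ⟨1, fun q hq => ?_⟩, by simp [hlen]⟩
  have hmem : w.foldl (delta n) q = n - 2 ∨ w.foldl (delta n) q = n - 1 := by
    rw [Finset.mem_Icc] at hq
    rcases hq.2.lt_or_eq with h | rfl
    · rw [hw q hq.1 (by omega)]
      omega
    · rw [hw' (by omega)]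
      omega
  rw [List.foldl_append]
  rcases hmem with h | h <;> rw [h] <;> simp only [List.foldl_cons, List.foldl_nil, delta] <;>
    split_ifs <;> omega

/-- `𝒟''ₙ` is synchronizing and its reset length is exactly `n² - 3n + 2`. -/
theorem dsecond_automaton_reset_length (n : ℕ) (hn : 4 ≤ n) :
    IsLeast {L : ℕ | ∃ w : List Letter, IsReset n w ∧ w.length = L}
      (n ^ 2 - 3 * n + 2) := by
  have hsq : n ^ 2 - 3 * n + 2 = (n - 3) * n + 2 := by rw [Nat.sub_mul, sq]
  have hmul : (n - 3) * n + 2 = (n - 1) * (n - 2) := by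
    obtain ⟨k, rfl⟩ := Nat.exists_eq_add_of_le hn
    rw [show 4 + k - 3 = k + 1 by omega, show 4 + k - 1 = k + 3 by omega,
      show 4 + k - 2 = k + 2 by omega]
    ring
  rw [hsq]
  refine ⟨exists_isReset n hn, ?_⟩
  rintro L ⟨w, hw, rfl⟩
  rw [hmul]
  exact le_length_of_isReset n hn w hw
end

section
/- For every integer n ≥ 4, every reset word for the automaton 𝒟''_n has length at least n² − 3n + 2. -/
/-- Reading a word advances the state by its length, up to the cycle lengths `n - 1` and `n`. -/
theorem foldl_delta_mem_and_eq (n : ℕ) (hn : 4 ≤ n) (w : List Letter) (q : ℕ)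
    (hq : q ∈ Finset.Icc 1 n) :
    w.foldl (delta n) q ∈ Finset.Icc 1 n ∧
      ∃ x y : ℕ, q + w.length = w.foldl (delta n) q + x * (n - 1) + y * n := by
  induction w generalizing q with
  | nil => exact ⟨hq, 0, 0, by simp⟩
  | cons c w ih =>
    have hstep : delta n q c ∈ Finset.Icc 1 n ∧
        ∃ x y : ℕ, q + 1 = delta n q c + x * (n - 1) + y * n := by
      rw [Finset.mem_Icc] at hq ⊢
      rcases lt_trichotomy q (n - 1) with h | h | h
      · cases c <;> simp only [delta, if_pos h] <;> exact ⟨by omega, 0, 0, by omega⟩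
      · cases c <;> simp only [delta, h, lt_irrefl, if_true, if_false]
        · exact ⟨by omega, 1, 0, by omega⟩
        · exact ⟨by omega, 0, 0, by omega⟩
      · cases c <;> simp only [delta, if_neg h.not_gt, if_neg h.ne']
        · exact ⟨by omega, 0, 1, by simp; omega⟩
        · exact ⟨by omega, 1, 0, by omega⟩
    obtain ⟨hmem, x, y, hxy⟩ := hstep
    obtain ⟨hmem', x', y', hxy'⟩ := ih _ hmem
    refine ⟨hmem', x + x', y + y', ?_⟩
    simp only [List.length_cons, List.foldl_cons, add_mul]
    omega

/-- The Frobenius number of `m` and `m + 1` is not a combination of them. -/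
theorem mul_add_mul_succ_ne (m x y : ℕ) : x * m + y * (m + 1) + m + 1 ≠ m * m := by
  intro h
  have hs : x + y + 1 < m := by
    by_contra! hle
    nlinarith
  nlinarith

/-- Every reset word for `𝒟''ₙ` has length at least `n² - 3n + 2`. -/
theorem dsecond_automaton_lower_bound (n : ℕ) (hn : 4 ≤ n)
    (w : List Letter) (hw : IsReset n w) :
    n ^ 2 - 3 * n + 2 ≤ w.length := by
  obtain ⟨p, hp⟩ := hw
  have hmem : p ∈ Finset.Icc 1 n := by
    have h1 : 1 ∈ Finset.Icc 1 n := Finset.mem_Icc.2 ⟨le_rfl, by omega⟩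
    exact hp 1 h1 ▸ (foldl_delta_mem_and_eq n hn w 1 h1).1
  by_contra! hlt
  obtain ⟨k, hk⟩ : ∃ k, k + w.length + 1 = n ^ 2 - 3 * n + 2 :=
    ⟨n ^ 2 - 3 * n + 2 - w.length - 1, by omega⟩
  have hclosed : (List.replicate k Letter.a ++ w).foldl (delta n) p = p := by
    rw [List.foldl_append]
    exact hp _ (foldl_delta_mem_and_eq n hn _ p hmem).1
  obtain ⟨-, x, y, hxy⟩ :=
    foldl_delta_mem_and_eq n hn (List.replicate k Letter.a ++ w) p hmem
  rw [hclosed, List.length_append, List.length_replicate] at hxy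
  obtain ⟨m, rfl⟩ : ∃ m, n = m + 1 := ⟨n - 1, by omega⟩
  have hsq : 3 * (m + 1) ≤ (m + 1) ^ 2 := by nlinarith
  rw [Nat.add_sub_cancel] at hxy
  apply mul_add_mul_succ_ne m x y
  have hexp : (m + 1) ^ 2 = m * m + 2 * m + 1 := by ring
  omega
end
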